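/- arXiv:2311.10603 — 2 statements merged into one kernel-verified Lean document; each statement's English description precedes it below -/
import Mathlib

section
/- Let λ be a symplectic partition and let i = (i_1, …, i_s) be a maximal admissible sequence for λ under the symplectic reduction rules. Then for every permutation σ of {1, …, s}, the sequence (i_{σ(1)}, …, i_{σ(s)}) is also a maximal admissible sequence for λ, and the resulting partition λ^{(i_{σ(1)}, …, i_{σ(s)})} is equal to λ^{i}. -/
/-- A type 1 reduction can be made to `lam` at position `i` (positions are 1-indexed). -/
def Type1At (lam : ℕ → ℕ) (i : ℕ) : Prop :=
  1 ≤ i ∧ lam (i + 1) + 2 ≤ lam i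

/-- A type 2 reduction can be made to `lam` at position `i`, where `par` is the parity
condition on `lam i` (`Even` in the symplectic case, `Odd` in the orthogonal case).
The inequality `lam 0 > lam 1` is regarded as automatically true. -/
def Type2At (par : ℕ → Prop) (lam : ℕ → ℕ) (i : ℕ) : Prop :=
  1 ≤ i ∧ par (lam i) ∧ (2 ≤ i → lam i < lam (i - 1)) ∧
    lam i = lam (i + 1) ∧ lam (i + 2) < lam (i + 1)

/-- `i` is an admissible position for `lam`. -/
def AdmissibleAt (par : ℕ → Prop) (lam : ℕ → ℕ) (i : ℕ) : Prop :=
  Type1At lam i ∨ Type2At par lam i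

/-- The result of a type 1 reduction at position `i`. -/
def red1 (lam : ℕ → ℕ) (i : ℕ) : ℕ → ℕ :=
  fun j => if 1 ≤ j ∧ j ≤ i then lam j - 2 else lam j

/-- The result of a type 2 reduction at position `i`. -/
def red2 (lam : ℕ → ℕ) (i : ℕ) : ℕ → ℕ :=
  fun j => if 1 ≤ j ∧ j < i then lam j - 2
    else if j = i ∨ j = i + 1 then lam j - 1 else lam j

/-- The reduction of `lam` at position `i`: of type 1 when a type 1 reduction can be made,
and otherwise of type 2 (at an admissible position at most one type of reduction applies). -/
def reduceAt (lam : ℕ → ℕ) (i : ℕ) : ℕ → ℕ :=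
  if lam (i + 1) + 2 ≤ lam i then red1 lam i else red2 lam i

/-- The partition `lam ^ l`, obtained by successively reducing at the positions listed in `l`. -/
def reduceList : (ℕ → ℕ) → List ℕ → (ℕ → ℕ)
  | lam, [] => lam
  | lam, i :: rest => reduceList (reduceAt lam i) rest

/-- `l` is an admissible sequence for `lam`. -/
def AdmissibleSeq (par : ℕ → Prop) : (ℕ → ℕ) → List ℕ → Prop
  | _, [] => True
  | lam, i :: rest => AdmissibleAt par lam i ∧ AdmissibleSeq par (reduceAt lam i) rest

/-- `l` is a maximal admissible sequence for `lam`. -/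
def MaxAdmissibleSeq (par : ℕ → Prop) (lam : ℕ → ℕ) (l : List ℕ) : Prop :=
  AdmissibleSeq par lam l ∧ ∀ i, ¬ AdmissibleAt par (reduceList lam l) i

/-- `lam` (1-indexed) is a partition: weakly decreasing with finitely many nonzero entries. -/
def IsPartition (lam : ℕ → ℕ) : Prop :=
  (∀ i, 1 ≤ i → lam (i + 1) ≤ lam i) ∧ ∃ N, ∀ i, N ≤ i → lam i = 0

/-- A symplectic partition: a partition of an even number in which every odd part occurs
with even multiplicity. -/
def IsSymplectic (lam : ℕ → ℕ) : Prop :=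
  IsPartition lam ∧
    (∃ N, (∀ i, N < i → lam i = 0) ∧ Even (∑ i ∈ Finset.Icc 1 N, lam i)) ∧
    ∀ p, Odd p → Even {i : ℕ | 1 ≤ i ∧ lam i = p}.ncard

/-- An orthogonal partition: a partition in which every positive even part occurs with
even multiplicity. -/
def IsOrthogonal (lam : ℕ → ℕ) : Prop :=
  IsPartition lam ∧
    ∀ p, 0 < p → Even p → Even {i : ℕ | 1 ≤ i ∧ lam i = p}.ncard

/-- The partition `(2r, 2r-2, ..., 4, 2)`. -/
def staircase (r : ℕ) : ℕ → ℕ :=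
  fun j => if 1 ≤ j ∧ j ≤ r then 2 * (r + 1 - j) else 0

/-- The partition `(2r-1, 2r-3, ..., 3, 1)`. -/
def oddStaircase (r : ℕ) : ℕ → ℕ :=
  fun j => if 1 ≤ j ∧ j ≤ r then 2 * (r + 1 - j) - 1 else 0

/-- Weakly decreasing from position 1 on. -/
def WeaklyDecreasing (lam : ℕ → ℕ) : Prop :=
  ∀ a b, 1 ≤ a → a ≤ b → lam b ≤ lam a

theorem weaklyDecreasing_of_succ_le {lam : ℕ → ℕ} (h : ∀ i, 1 ≤ i → lam (i + 1) ≤ lam i) :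
    WeaklyDecreasing lam := by
  intro a b ha hab
  induction b, hab using Nat.le_induction with
  | base => exact le_rfl
  | succ n hn ih => exact (h n (ha.trans hn)).trans ih

theorem IsPartition.weaklyDecreasing {lam : ℕ → ℕ} (h : IsPartition lam) :
    WeaklyDecreasing lam :=
  weaklyDecreasing_of_succ_le h.1

theorem WeaklyDecreasing.reduceAt {lam : ℕ → ℕ} (h : WeaklyDecreasing lam) {i : ℕ}
    (hi : AdmissibleAt Even lam i) : WeaklyDecreasing (reduceAt lam i) := by
  apply weaklyDecreasing_of_succ_le
  intro k hk
  have h1 := h k (k + 1) hk (by omega)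
  rcases hi with ⟨hi1, h2⟩ | ⟨hi1, -, h2, h3, h4⟩
  · rw [_root_.reduceAt, if_pos h2]
    simp only [red1]
    rcases lt_trichotomy k i with hki | rfl | hki <;> split_ifs <;> omega
  · rw [_root_.reduceAt, if_neg (by omega)]
    simp only [red2]
    by_cases e1 : k + 1 = i
    · subst e1
      simp only [Nat.add_sub_cancel] at h2
      have := h2 (by omega)
      split_ifs <;> omega
    · by_cases e2 : k = i
      · subst e2
        split_ifs <;> omega
      · by_cases e3 : k = i + 1
        · subst e3
          simp only [add_assoc, Nat.reduceAdd] at *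
          split_ifs <;> omega
        · split_ifs <;> omega

theorem Type1At.reduceAt_apply {lam : ℕ → ℕ} (h : WeaklyDecreasing lam) {i : ℕ}
    (hi : Type1At lam i) (k : ℕ) (hk : 1 ≤ k) :
    (k ≤ i → reduceAt lam i k + 2 = lam k) ∧ (i < k → reduceAt lam i k = lam k) := by
  have := h k i hk
  have := hi.2
  rw [reduceAt, if_pos hi.2]
  simp only [red1]
  constructor <;> intro _ <;> split_ifs <;> omega

theorem Type2At.reduceAt_apply {lam : ℕ → ℕ} (h : WeaklyDecreasing lam) {i : ℕ}
    (hi : Type2At Even lam i) (k : ℕ) (hk : 1 ≤ k) :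
    (k < i → reduceAt lam i k + 2 = lam k) ∧ (k = i → reduceAt lam i k + 1 = lam k) ∧
      (k = i + 1 → reduceAt lam i k + 1 = lam k) ∧
      (i + 1 < k → reduceAt lam i k = lam k) := by
  obtain ⟨hi1, -, h2, h3, h4⟩ := hi
  have h5 := h k (i - 1) hk
  rw [reduceAt, if_neg (by omega)]
  simp only [red2]
  refine ⟨?_, ?_, ?_, ?_⟩ <;> rintro h6 <;> try subst h6
  all_goals split_ifs <;> omega

/-- Successive reductions at two positions can be interchanged. -/
theorem AdmissibleAt.swap {lam : ℕ → ℕ} (h : WeaklyDecreasing lam) {i j : ℕ}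
    (hi : AdmissibleAt Even lam i) (hj : AdmissibleAt Even (reduceAt lam i) j) :
    AdmissibleAt Even lam j ∧ AdmissibleAt Even (reduceAt lam j) i ∧
      reduceAt (reduceAt lam i) j = reduceAt (reduceAt lam j) i := by
  rcases eq_or_ne i j with rfl | hij
  · exact ⟨hi, hj, rfl⟩
  have key : AdmissibleAt Even lam j ∧ AdmissibleAt Even (reduceAt lam j) i ∧
      (lam (i + 1) + 2 ≤ lam i ↔ reduceAt lam j (i + 1) + 2 ≤ reduceAt lam j i) ∧
      (lam (j + 1) + 2 ≤ lam j ↔ reduceAt lam i (j + 1) + 2 ≤ reduceAt lam i j) := by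
    rcases hi with hi | hi
    · have si := hi.reduceAt_apply h
      rcases hj with hj | hj
      · have hj' : Type1At lam j := by
          grind [Type1At]
        have sj := hj'.reduceAt_apply h
        grind [AdmissibleAt, Type1At]
      · have hj' : Type2At Even lam j := by
          grind [Type2At]
        have sj := hj'.reduceAt_apply h
        grind [AdmissibleAt, Type1At, Type2At]
    · have si := hi.reduceAt_apply h
      rcases hj with hj | hj
      · have hj' : Type1At lam j := by
          grind [Type1At, Type2At]
        have sj := hj'.reduceAt_apply h
        grind [AdmissibleAt, Type1At, Type2At]
      · have hfar : i + 1 < j ∨ j + 1 < i := by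
          grind [Type2At]
        have hj' : Type2At Even lam j := by
          rcases hfar with hfar | hfar <;> grind [Type2At]
        have sj := hj'.reduceAt_apply h
        have hi' : Type2At Even (reduceAt lam j) i := by
          rcases hfar with hfar | hfar
          · rcases eq_or_lt_of_le (Nat.succ_le_of_lt hfar) with hfar | hfar <;> grind [Type2At]
          · grind [Type2At]
        refine ⟨.inr hj', .inr hi', ?_, ?_⟩ <;> grind [Type2At]
  obtain ⟨k1, k2, k3, k4⟩ := key
  refine ⟨k1, k2, ?_⟩
  refine (if_congr k4.symm rfl rfl).trans (Eq.trans ?_ (if_congr k3 rfl rfl))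
  funext k
  by_cases a : lam (i + 1) + 2 ≤ lam i <;> by_cases b : lam (j + 1) + 2 ≤ lam j <;>
    simp only [reduceAt, a, b, if_true, if_false, red1, red2] <;> split_ifs <;> omega

theorem AdmissibleSeq.perm {l l' : List ℕ} (hp : l.Perm l') :
    ∀ {lam : ℕ → ℕ}, WeaklyDecreasing lam → AdmissibleSeq Even lam l →
      AdmissibleSeq Even lam l' ∧ reduceList lam l' = reduceList lam l := by
  induction hp with
  | nil => exact fun _ h => ⟨h, rfl⟩
  | cons i _ ih =>
    intro lam hd h
    obtain ⟨h1, h2⟩ := ih (hd.reduceAt h.1) h.2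
    exact ⟨⟨h.1, h1⟩, h2⟩
  | swap i j l =>
    intro lam hd h
    obtain ⟨h1, h2, h3⟩ := AdmissibleAt.swap hd h.1 h.2.1
    refine ⟨⟨h1, h2, ?_⟩, ?_⟩
    · rw [← h3]
      exact h.2.2
    · simp only [reduceList, h3]
  | trans _ _ ih1 ih2 =>
    intro lam hd h
    obtain ⟨h1, h2⟩ := ih1 hd h
    obtain ⟨h3, h4⟩ := ih2 hd h1
    exact ⟨h3, h4.trans h2⟩

/-- any reordering of a maximal admissible sequence for a symplectic
partition is again a maximal admissible sequence, with the same resulting partition. -/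
theorem ks_reorder_symplectic (lam : ℕ → ℕ) (hlam : IsSymplectic lam)
    (l l' : List ℕ) (hl : MaxAdmissibleSeq Even lam l) (hperm : l'.Perm l) :
    MaxAdmissibleSeq Even lam l' ∧ reduceList lam l' = reduceList lam l := by
  obtain ⟨h1, h2⟩ := hl.1.perm hperm.symm hlam.1.weaklyDecreasing
  refine ⟨⟨h1, ?_⟩, h2⟩
  rw [h2]
  exact hl.2
end

section
/- Let V be a finite-dimensional complex vector space, let W be a finite group acting on V by ℂ-linear automorphisms, fix ρ ∈ V, and define the dot action of W on V by w • v := w·(v + ρ) − ρ. Let m ∈ ℤ_{≥0}, let μ_0, μ_1, …, μ_m ∈ V and let z_0, z_1, …, z_m ⊆ V be ℂ-linear subspaces. If the coset μ_0 + z_0 is contained in the union ⋃_{i=1}^{m} ⋃_{w ∈ W} w • (μ_i + z_i), then there exist i_0 ∈ {1, …, m} and w_0 ∈ W such that z_0 ⊆ w_0 · z_{i_0}. -/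
open scoped Pointwise in
/-- If a subspace over an infinite field is covered by finitely many affine cosets `a i + p i`,
then it is contained in the direction `p i` of one of them. -/
theorem Submodule.exists_le_of_forall_exists_sub_mem {k E ι : Type*} [Field k] [Infinite k]
    [AddCommGroup E] [Module k E] [Finite ι] (q : Submodule k E) (a : ι → E)
    (p : ι → Submodule k E) (h : ∀ x ∈ q, ∃ i, x - a i ∈ p i) : ∃ i, q ≤ p i := by
  have := Fintype.ofFinite ι
  -- The cosets meeting `q` can be recentred at points of `q`.
  have hrecentre : ∀ i, ∃ g : q, ∀ x : q, (x : E) - a i ∈ p i → (x : E) - g ∈ p i := by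
    intro i
    by_cases hi : ∃ y : q, (y : E) - a i ∈ p i
    · obtain ⟨y, hy⟩ := hi
      exact ⟨y, fun x hx => by simpa using (p i).sub_mem hx hy⟩
    · exact ⟨0, fun x hx => (hi ⟨x, hx⟩).elim⟩
  choose g hg using hrecentre
  have hcovers : ⋃ i ∈ (Finset.univ : Finset ι),
      g i +ᵥ (((p i).comap q.subtype).toAddSubgroup : Set q) = Set.univ := by
    refine Set.eq_univ_of_forall fun x => ?_
    obtain ⟨i, hi⟩ := h x x.2
    refine Set.mem_iUnion₂.mpr ⟨i, Finset.mem_univ i, x - g i, ?_, ?_⟩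
    · simpa using hg i x hi
    · simp
  obtain ⟨i, -, hfi⟩ := AddSubgroup.exists_finiteIndex_of_leftCoset_cover hcovers
  refine ⟨i, Submodule.comap_subtype_eq_top.mp ?_⟩
  by_contra hne
  have : Finite (q ⧸ (p i).comap q.subtype) := AddSubgroup.finite_quotient_of_finiteIndex
  have : Nontrivial (q ⧸ (p i).comap q.subtype) := Submodule.Quotient.nontrivial_iff.mpr hne
  have : Infinite (q ⧸ (p i).comap q.subtype) := Module.Free.infinite k _
  exact not_finite (q ⧸ (p i).comap q.subtype)

/-- let `W` be a finite group acting on a finite-dimensional complex vector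
space `V` by `ℂ`-linear automorphisms (via `φ`), and define the dot action by
`w • v = φ w (v + ρ) - ρ`.  If the affine coset `μ0 + z0` is contained in the union of the
dot-translates `w • (μ i + z i)` for `i = 1, ..., m` and `w ∈ W`, then `z0` is contained in
`φ w0 '' (z i0)` for some `i0` and some `w0 ∈ W`. -/
theorem coset_covering_group (V : Type*) [AddCommGroup V] [Module ℂ V]
    [FiniteDimensional ℂ V]
    (W : Type*) [Group W] [Finite W] (φ : W →* (V ≃ₗ[ℂ] V)) (ρ : V)
    (m : ℕ) (μ0 : V) (z0 : Submodule ℂ V) (μ : Fin m → V) (z : Fin m → Submodule ℂ V)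
    (hsub : (fun x => μ0 + x) '' (z0 : Set V) ⊆
      ⋃ (i : Fin m) (w : W),
        (fun v => φ w (v + ρ) - ρ) '' ((fun x => μ i + x) '' (z i : Set V))) :
    ∃ (i0 : Fin m) (w0 : W), (z0 : Set V) ⊆ (φ w0) '' (z i0 : Set V) := by
  obtain ⟨⟨i, w⟩, hle⟩ := z0.exists_le_of_forall_exists_sub_mem
    (fun j : Fin m × W => φ j.2 (μ j.1 + ρ) - ρ - μ0)
    (fun j => (z j.1).map (φ j.2).toLinearMap) (by
      intro x hx
      obtain ⟨i, w, _, ⟨y, hy, rfl⟩, hxy⟩ := by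
        simpa only [Set.mem_iUnion] using hsub ⟨x, hx, rfl⟩
      refine ⟨(i, w), y, hy, ?_⟩
      have hx' : x = φ w (μ i + y + ρ) - ρ - μ0 := eq_sub_of_add_eq' hxy.symm
      simp only [hx', map_add, LinearEquiv.coe_coe]
      abel)
  exact ⟨i, w, hle⟩
end
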